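/- Under the multiplex RWM recursion, for every network index i there exists a matrix 𝒫_i^{(∞)} such that 𝒫_i^{(t)} converges entrywise to 𝒫_i^{(∞)} as t → ∞, and for every t one has ‖𝒫_i^{(∞)} − 𝒫_i^{(t)}‖_∞ ≤ λ^t · K/(1−λ); consequently, for every ε with 0 < ε < 1 and every t with λ^t < ε(1−λ)/K, one has ‖𝒫_i^{(∞)} − 𝒫_i^{(t)}‖_∞ < ε. -/

import Mathlib

open Finset Filter Matrix Topology

/-- Cosine similarity of two vectors in `ℝ^n` (0 when a denominator vanishes,
since division by zero is 0 in Lean). -/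
noncomputable def cosSim {n : ℕ} (u v : Fin n → ℝ) : ℝ :=
  (∑ k, u k * v k) / (Real.sqrt (∑ k, u k * u k) * Real.sqrt (∑ k, v k * v k))

/-- The maximum of the absolute values of the entries of a real matrix. -/
noncomputable def matInfNorm {m n : ℕ} (M : Matrix (Fin m) (Fin n) ℝ) : ℝ :=
  ⨆ p : Fin m × Fin n, |M p.1 p.2|

/-- The joint state `(W^{(t)}, x^{(t)})` of the multiplex RWM recursion:
`W^{(0)} = I`, `x^{(0)}` given; `Ŵ^{(t)}(i,j) = W^{(t)}(i,j)/∑_k W^{(t)}(i,k)`,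
`𝒫_i^{(t)} = ∑_j Ŵ^{(t)}(i,j) P_j`, `x_i^{(t+1)} = 𝒫_i^{(t)} x_i^{(t)}`, and
`W^{(t+1)}(i,j) = W^{(t)}(i,j) + λ^{t+1} cos(x_i^{(t+1)}, x_j^{(t+1)})`. -/
noncomputable def rwmState {K n : ℕ} (lam : ℝ) (P : Fin K → Matrix (Fin n) (Fin n) ℝ)
    (x0 : Fin K → Fin n → ℝ) : ℕ → Matrix (Fin K) (Fin K) ℝ × (Fin K → Fin n → ℝ)
  | 0 => (1, x0)
  | t + 1 =>
      let Wt := (rwmState lam P x0 t).1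
      let xt := (rwmState lam P x0 t).2
      let What : Matrix (Fin K) (Fin K) ℝ := Matrix.of fun i j => Wt i j / ∑ k, Wt i k
      let Pmod : Fin K → Matrix (Fin n) (Fin n) ℝ := fun i => ∑ j, What i j • P j
      let xNew : Fin K → Fin n → ℝ := fun i => (Pmod i).mulVec (xt i)
      (Matrix.of fun i j => Wt i j + lam ^ (t + 1) * cosSim (xNew i) (xNew j), xNew)

/-- The relevance weight matrix `W^{(t)}`. -/
noncomputable def rwmW {K n : ℕ} (lam : ℝ) (P : Fin K → Matrix (Fin n) (Fin n) ℝ)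
    (x0 : Fin K → Fin n → ℝ) (t : ℕ) : Matrix (Fin K) (Fin K) ℝ :=
  (rwmState lam P x0 t).1

/-- The visiting probability vector `x_i^{(t)}`. -/
noncomputable def rwmX {K n : ℕ} (lam : ℝ) (P : Fin K → Matrix (Fin n) (Fin n) ℝ)
    (x0 : Fin K → Fin n → ℝ) (t : ℕ) (i : Fin K) : Fin n → ℝ :=
  (rwmState lam P x0 t).2 i

/-- The row-normalized relevance weight matrix `Ŵ^{(t)}`. -/
noncomputable def rwmWhat {K n : ℕ} (lam : ℝ) (P : Fin K → Matrix (Fin n) (Fin n) ℝ)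
    (x0 : Fin K → Fin n → ℝ) (t : ℕ) : Matrix (Fin K) (Fin K) ℝ :=
  Matrix.of fun i j => rwmW lam P x0 t i j / ∑ k, rwmW lam P x0 t i k

/-- The modified transition matrix `𝒫_i^{(t)} = ∑_j Ŵ^{(t)}(i,j) P_j`. -/
noncomputable def rwmPmod {K n : ℕ} (lam : ℝ) (P : Fin K → Matrix (Fin n) (Fin n) ℝ)
    (x0 : Fin K → Fin n → ℝ) (t : ℕ) (i : Fin K) : Matrix (Fin n) (Fin n) ℝ :=
  ∑ j, rwmWhat lam P x0 t i j • P j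

lemma cosSim_nonneg {n : ℕ} {u v : Fin n → ℝ} (hu : ∀ k, 0 ≤ u k) (hv : ∀ k, 0 ≤ v k) :
    0 ≤ cosSim u v :=
  div_nonneg (Finset.sum_nonneg fun k _ => mul_nonneg (hu k) (hv k)) (by positivity)

lemma cosSim_le_one {n : ℕ} (u v : Fin n → ℝ) : cosSim u v ≤ 1 := by
  refine div_le_one_of_le₀ ?_ (by positivity)
  simpa only [sq] using Real.sum_mul_le_sqrt_mul_sqrt Finset.univ u v

section Recursion

variable {K n : ℕ} {lam : ℝ} {P : Fin K → Matrix (Fin n) (Fin n) ℝ} {x0 : Fin K → Fin n → ℝ}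

lemma rwmX_succ (t : ℕ) (i : Fin K) :
    rwmX lam P x0 (t + 1) i = (rwmPmod lam P x0 t i).mulVec (rwmX lam P x0 t i) := rfl

lemma rwmW_succ (t : ℕ) (i j : Fin K) :
    rwmW lam P x0 (t + 1) i j = rwmW lam P x0 t i j +
      lam ^ (t + 1) * cosSim (rwmX lam P x0 (t + 1) i) (rwmX lam P x0 (t + 1) j) := rfl

lemma rwmPmod_apply (t : ℕ) (i : Fin K) (v u : Fin n) :
    rwmPmod lam P x0 t i v u =
      (∑ j, rwmW lam P x0 t i j * P j v u) / ∑ k, rwmW lam P x0 t i k := by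
  simp only [rwmPmod, rwmWhat, Matrix.sum_apply, Matrix.smul_apply, Matrix.of_apply, smul_eq_mul,
    Finset.sum_div]
  exact Finset.sum_congr rfl fun j _ => by ring

lemma rwmW_and_rwmX_nonneg (hlam : 0 ≤ lam) (hP : ∀ j v u, 0 ≤ P j v u)
    (hx0 : ∀ i v, 0 ≤ x0 i v) (t : ℕ) :
    (∀ i j, 0 ≤ rwmW lam P x0 t i j) ∧ ∀ i v, 0 ≤ rwmX lam P x0 t i v := by
  induction t with
  | zero =>
    refine ⟨fun i j => ?_, hx0⟩
    change 0 ≤ (1 : Matrix (Fin K) (Fin K) ℝ) i j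
    rw [Matrix.one_apply]
    split_ifs <;> norm_num
  | succ t ih =>
    obtain ⟨hW, hx⟩ := ih
    have hx' : ∀ i v, 0 ≤ rwmX lam P x0 (t + 1) i v := fun i v => by
      rw [rwmX_succ, Matrix.mulVec, dotProduct]
      refine Finset.sum_nonneg fun u _ => mul_nonneg ?_ (hx i u)
      rw [rwmPmod_apply]
      exact div_nonneg (Finset.sum_nonneg fun j _ => mul_nonneg (hW i j) (hP j v u))
        (Finset.sum_nonneg fun j _ => hW i j)
    refine ⟨fun i j => ?_, hx'⟩
    rw [rwmW_succ]
    exact add_nonneg (hW i j) (mul_nonneg (by positivity) (cosSim_nonneg (hx' i) (hx' j)))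

lemma one_le_rwmW_diag (hlam : 0 ≤ lam) (hP : ∀ j v u, 0 ≤ P j v u)
    (hx0 : ∀ i v, 0 ≤ x0 i v) (t : ℕ) (i : Fin K) : 1 ≤ rwmW lam P x0 t i i := by
  induction t with
  | zero => exact (Matrix.one_apply_eq i).ge
  | succ t ih =>
    have hx := (rwmW_and_rwmX_nonneg hlam hP hx0 (t + 1)).2 i
    rw [rwmW_succ]
    exact le_add_of_le_of_nonneg ih (mul_nonneg (by positivity) (cosSim_nonneg hx hx))

lemma one_le_sum_rwmW (hlam : 0 ≤ lam) (hP : ∀ j v u, 0 ≤ P j v u)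
    (hx0 : ∀ i v, 0 ≤ x0 i v) (t : ℕ) (i : Fin K) : 1 ≤ ∑ k, rwmW lam P x0 t i k :=
  (one_le_rwmW_diag hlam hP hx0 t i).trans <|
    Finset.single_le_sum (f := fun k => rwmW lam P x0 t i k)
      (fun k _ => (rwmW_and_rwmX_nonneg hlam hP hx0 t).1 i k) (Finset.mem_univ i)

end Recursion

/-- Adding nonnegative amounts `a` to the weights `w` (of total at least `1`) changes the weighted
average of numbers `p j ∈ [0, 1]` by at most the total of `a`. -/
lemma abs_weighted_average_sub_le {ι : Type*} [Fintype ι] {w a p : ι → ℝ}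
    (hw : ∀ j, 0 ≤ w j) (hS : 1 ≤ ∑ j, w j) (ha : ∀ j, 0 ≤ a j)
    (hp0 : ∀ j, 0 ≤ p j) (hp1 : ∀ j, p j ≤ 1) :
    |(∑ j, w j * p j) / (∑ j, w j) - (∑ j, (w j + a j) * p j) / ∑ j, (w j + a j)| ≤
      ∑ j, a j := by
  simp only [add_mul, Finset.sum_add_distrib]
  have hA : 0 ≤ ∑ j, a j := Finset.sum_nonneg fun j _ => ha j
  have hwp : 0 ≤ ∑ j, w j * p j := Finset.sum_nonneg fun j _ => mul_nonneg (hw j) (hp0 j)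
  have hap : 0 ≤ ∑ j, a j * p j := Finset.sum_nonneg fun j _ => mul_nonneg (ha j) (hp0 j)
  have hwp' : ∑ j, w j * p j ≤ ∑ j, w j :=
    Finset.sum_le_sum fun j _ => mul_le_of_le_one_right (hw j) (hp1 j)
  have hap' : ∑ j, a j * p j ≤ ∑ j, a j :=
    Finset.sum_le_sum fun j _ => mul_le_of_le_one_right (ha j) (hp1 j)
  generalize ∑ j, w j = S at *
  generalize ∑ j, a j = A at *
  generalize ∑ j, w j * p j = B at *
  generalize ∑ j, a j * p j = C at *
  have hSpos : 0 < S := by linarith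
  have hSA : 1 ≤ S + A := by linarith
  have hq0 : 0 ≤ B / S := div_nonneg hwp hSpos.le
  have hq1 : B / S ≤ 1 := div_le_one_of_le₀ hwp' hSpos.le
  have key : B / S - (B + C) / (S + A) = (A * (B / S) - C) / (S + A) := by
    have : S + A ≠ 0 := by linarith
    field_simp
    ring
  have hnum : |A * (B / S) - C| ≤ A := by
    rw [abs_le]
    constructor <;> nlinarith [mul_nonneg hA hq0, mul_le_of_le_one_right hA hq1]
  rw [key, abs_div, abs_of_pos (by linarith : 0 < S + A)]
  exact (div_le_self (abs_nonneg _) hSA).trans hnum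

lemma dist_rwmPmod_succ_le {K n : ℕ} {lam : ℝ} (hlam0 : 0 ≤ lam) (hlam1 : lam ≤ 1)
    {P : Fin K → Matrix (Fin n) (Fin n) ℝ} {x0 : Fin K → Fin n → ℝ}
    (hPnn : ∀ j v u, 0 ≤ P j v u) (hPle : ∀ j v u, P j v u ≤ 1) (hx0 : ∀ i v, 0 ≤ x0 i v)
    (t : ℕ) (i : Fin K) (v u : Fin n) :
    dist (rwmPmod lam P x0 t i v u) (rwmPmod lam P x0 (t + 1) i v u) ≤ K * lam ^ t := by
  have hx := (rwmW_and_rwmX_nonneg hlam0 hPnn hx0 (t + 1)).2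
  simp only [Real.dist_eq, rwmPmod_apply, rwmW_succ]
  refine (abs_weighted_average_sub_le ((rwmW_and_rwmX_nonneg hlam0 hPnn hx0 t).1 i)
    (one_le_sum_rwmW hlam0 hPnn hx0 t i)
    (fun j => mul_nonneg (by positivity) (cosSim_nonneg (hx i) (hx j)))
    (fun j => hPnn j v u) fun j => hPle j v u).trans ?_
  calc ∑ j, lam ^ (t + 1) * cosSim (rwmX lam P x0 (t + 1) i) (rwmX lam P x0 (t + 1) j)
      ≤ ∑ _j : Fin K, lam ^ t := Finset.sum_le_sum fun j _ =>
        (mul_le_of_le_one_right (by positivity) (cosSim_le_one _ _)).trans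
          (pow_le_pow_of_le_one hlam0 hlam1 t.le_succ)
    _ = K * lam ^ t := by simp

/-- Under the multiplex RWM recursion, for every network index `i` there exists a matrix
`𝒫_i^{(∞)}` such that `𝒫_i^{(t)} → 𝒫_i^{(∞)}` entrywise, with
`‖𝒫_i^{(∞)} − 𝒫_i^{(t)}‖_∞ ≤ λ^t K/(1−λ)` for every `t`; consequently, for every
`0 < ε < 1` and every `t` with `λ^t < ε(1−λ)/K`, `‖𝒫_i^{(∞)} − 𝒫_i^{(t)}‖_∞ < ε`. -/
theorem rwm_multiplex_transition_limit_early_stopping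
    (K n : ℕ) (hK : 1 ≤ K) (hn : 1 ≤ n)
    (lam : ℝ) (hlam0 : 0 < lam) (hlam1 : lam < 1)
    (P : Fin K → Matrix (Fin n) (Fin n) ℝ)
    (hPnn : ∀ j v u, 0 ≤ P j v u) (hPcol : ∀ j u, ∑ v, P j v u = 1)
    (x0 : Fin K → Fin n → ℝ)
    (hx0nn : ∀ i v, 0 ≤ x0 i v) (hx0sum : ∀ i, ∑ v, x0 i v = 1) :
    ∀ i : Fin K, ∃ Pinf : Matrix (Fin n) (Fin n) ℝ,
      (∀ v u, Tendsto (fun t => rwmPmod lam P x0 t i v u) atTop (𝓝 (Pinf v u))) ∧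
      (∀ t : ℕ, matInfNorm (Pinf - rwmPmod lam P x0 t i) ≤ lam ^ t * K / (1 - lam)) ∧
      (∀ ε : ℝ, 0 < ε → ε < 1 → ∀ t : ℕ, lam ^ t < ε * (1 - lam) / K →
        matInfNorm (Pinf - rwmPmod lam P x0 t i) < ε) := by
  intro i
  have hPle : ∀ j v u, P j v u ≤ 1 := fun j v u => by
    rw [← hPcol j u]
    exact Finset.single_le_sum (f := fun v => P j v u) (fun v _ => hPnn j v u) (Finset.mem_univ v)
  have hstep := fun v u t => dist_rwmPmod_succ_le hlam0.le hlam1.le hPnn hPle hx0nn t i v u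
  choose Pinf hlim using fun v u =>
    cauchySeq_tendsto_of_complete (cauchySeq_of_le_geometric lam K hlam1 (hstep v u))
  have hpos : 0 < 1 - lam := sub_pos.2 hlam1
  have hbound : ∀ t : ℕ, matInfNorm (Matrix.of Pinf - rwmPmod lam P x0 t i) ≤
      lam ^ t * K / (1 - lam) := fun t => by
    refine Real.iSup_le (fun ⟨v, u⟩ => ?_) (by positivity)
    have h := dist_le_of_le_geometric_of_tendsto lam K hlam1 (hstep v u) (hlim v u) t
    rwa [dist_comm, Real.dist_eq, mul_comm (K : ℝ)] at h
  refine ⟨Matrix.of Pinf, hlim, hbound, fun ε _ _ t ht => (hbound t).trans_lt ?_⟩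
  have hKpos : (0 : ℝ) < K := by exact_mod_cast hK
  rwa [div_lt_iff₀ hpos, ← lt_div_iff₀ hKpos]
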